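/- Assume T > R > P > S, 2R > T + S, 0 ≤ γ < 1 and γ > (T−R)/(R−P). Let τ be the Win-Stay Lose-Shift (WSLS) strategy viewed as a memory-two strategy: τ(s1,s2) = C if s1 ∈ {(C,C),(D,D)} and τ(s1,s2) = D otherwise (this strategy is invariant under swapping the two players, so its mirror coincides with τ). Then there exists Q : {C,D} × Ω × Ω → ℝ satisfying the player-1 memory-two Bellman optimality equation against τ such that for all states s1, s2: if s1 ∈ {(C,C),(D,D)} then Q(C,s1,s2) > Q(D,s1,s2), and if s1 ∈ {(C,D),(D,C)} then Q(D,s1,s2) > Q(C,s1,s2); that is, a pair of WSLS strategies forms a symmetric mutual reinforcement learning equilibrium under memory-two reinforcement learning. -/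

import Mathlib

inductive Act where
  | C : Act
  | D : Act
deriving DecidableEq

open Act

abbrev St : Type := Act × Act

/-- Player 1's payoff in the prisoner's dilemma. -/
def r1 (R S T P : ℝ) : Act → Act → ℝ
  | C, C => R
  | C, D => S
  | D, C => T
  | D, D => P

/-- Swap the roles of the two players in a state. -/
def pi' (s : St) : St := (s.2, s.1)

/-- the Win-Stay Lose-Shift strategy, viewed as a memory-two strategy, forms a
symmetric mutual reinforcement learning equilibrium under memory-two reinforcement learning
when `γ > (T−R)/(R−P)`. -/
theorem stmt_18 (R S T P γ : ℝ) (hTR : T > R) (hRP : R > P) (hPS : P > S)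
    (h2R : 2 * R > T + S) (hγ0 : 0 ≤ γ) (hγ1 : γ < 1)
    (hγc : γ > (T - R) / (R - P))
    (τ : St → St → Act)
    (hτ : ∀ s1 s2, τ s1 s2 = if s1 = (C, C) ∨ s1 = (D, D) then C else D) :
    ∃ Q : Act → St → St → ℝ,
      (∀ σ s1 s2, Q σ s1 s2 =
        r1 R S T P σ (τ s1 s2) +
          γ * max (Q C (σ, τ s1 s2) s1) (Q D (σ, τ s1 s2) s1)) ∧
      (∀ s1 s2 : St, (s1 = (C, C) ∨ s1 = (D, D) → Q C s1 s2 > Q D s1 s2) ∧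
        (s1 = (C, D) ∨ s1 = (D, C) → Q D s1 s2 > Q C s1 s2)) := by
  have hgain : T - R < γ * (R - P) := (div_lt_iff₀ (sub_pos.mpr hRP)).mp hγc
  have hγRP : 0 ≤ γ * (R - P) := mul_nonneg hγ0 (sub_pos.mpr hRP).le
  obtain ⟨V, hV⟩ : ∃ V : ℝ, V = R + γ * V :=
    ⟨R / (1 - γ), by have : 1 - γ ≠ 0 := (sub_pos.mpr hγ1).ne'
                     field_simp
                     ring⟩
  have hγV : γ * (γ * V) = γ * V - γ * R := by linear_combination -γ * hV
  have hgood : T + γ * (P + γ * V) < R + γ * V := by linarith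
  have hbad : S + γ * (P + γ * V) < P + γ * V := by linarith
  refine ⟨fun σ s1 s2 => r1 R S T P σ (τ s1 s2) +
    γ * (if σ = τ s1 s2 then V else P + γ * V), ?_, ?_⟩
  · rintro (_ | _) ⟨_ | _, _ | _⟩ s2 <;>
      simp [hτ, r1, hgood.le.trans_eq hV.symm, max_eq_right hbad.le, ← hV]
  · rintro ⟨_ | _, _ | _⟩ s2 <;> simp [hτ, r1, hgood, hbad]
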